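/- Under the SAGA setup (each f_i convex, differentiable and L-smooth, not necessarily strongly convex) with step size γ = 1/(3L), initialize φ_i^0 = x^0 for all i and run k SAGA update steps, choosing the index at each step independently and uniformly at random (so E below is the average over all n^k index sequences). Then for the average iterate x̄^k = (1/k)∑_{t=1}^k x^t: E[F(x̄^k)] − F(x*) ≤ (10n/k)[(2L/n)‖x^0 − x*‖² + f(x^0) − ⟨∇f(x*), x^0 − x*⟩ − f(x*)]. -/

import Mathlib

open scoped RealInnerProductSpace

/-- The SAGA pre-proximal point `w^(j)` for iterate `x`, table `φ` and index `j`. -/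
noncomputable def sagaW (d n : ℕ) (γ : ℝ)
    (f' : Fin n → EuclideanSpace ℝ (Fin d) → EuclideanSpace ℝ (Fin d))
    (x : EuclideanSpace ℝ (Fin d)) (φ : Fin n → EuclideanSpace ℝ (Fin d))
    (j : Fin n) : EuclideanSpace ℝ (Fin d) :=
  x - γ • (f' j x - f' j (φ j) + (1 / (n : ℝ)) • ∑ i, f' i (φ i))

/-- The SAGA state (iterate, table) after `k` update steps with index sequence `js`,
where `prox` is the proximal operator of `h` with weight `1/γ`. -/
noncomputable def sagaIter (d n : ℕ) (γ : ℝ)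
    (f' : Fin n → EuclideanSpace ℝ (Fin d) → EuclideanSpace ℝ (Fin d))
    (prox : EuclideanSpace ℝ (Fin d) → EuclideanSpace ℝ (Fin d))
    (x0 : EuclideanSpace ℝ (Fin d)) (js : ℕ → Fin n) :
    ℕ → EuclideanSpace ℝ (Fin d) × (Fin n → EuclideanSpace ℝ (Fin d))
  | 0 => (x0, fun _ => x0)
  | k + 1 =>
      (prox (sagaW d n γ f' (sagaIter d n γ f' prox x0 js k).1
          (sagaIter d n γ f' prox x0 js k).2 (js k)),
       Function.update (sagaIter d n γ f' prox x0 js k).2 (js k)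
          (sagaIter d n γ f' prox x0 js k).1)

/-- Extends a finite index sequence to an infinite one (the tail is irrelevant). -/
def extSeq {n : ℕ} (hn : 0 < n) {k : ℕ} (js : Fin k → Fin n) : ℕ → Fin n :=
  fun t => if h : t < k then js ⟨t, h⟩ else ⟨0, hn⟩

section SagaAux

variable {E : Type*} [NormedAddCommGroup E] [InnerProductSpace ℝ E]

/-- Small-parameter limit argument. -/
lemma saga_eps {a b c : ℝ} (H : ∀ s : ℝ, 0 < s → s ≤ 1 → s * a ≤ s * b + s ^ 2 * c) :
    a ≤ b := by
  refine le_of_forall_pos_le_add fun ε hε => ?_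
  set s := min 1 (ε / (|c| + 1)) with hs
  have hs0 : 0 < s := lt_min one_pos (by positivity)
  have h1 := H s hs0 (min_le_left _ _)
  have h2 : s * (|c| + 1) ≤ ε := by
    rw [← le_div_iff₀ (by positivity)]; exact min_le_right _ _
  have h3 : a ≤ b + s * c := by
    by_contra hlt
    push Not at hlt
    nlinarith [mul_lt_mul_of_pos_left hlt hs0]
  nlinarith [le_abs_self c, mul_le_mul_of_nonneg_left (le_abs_self c) hs0.le]

lemma saga_prox_three {h : E → ℝ} (hh : ConvexOn ℝ Set.univ h) {c : ℝ} {p w : E}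
    (hp : ∀ y, h p + c * ‖p - w‖ ^ 2 ≤ h y + c * ‖y - w‖ ^ 2) (y : E) :
    h p + c * ‖p - w‖ ^ 2 + c * ‖y - p‖ ^ 2 ≤ h y + c * ‖y - w‖ ^ 2 := by
  have key : h p - h y ≤ c * (2 * ⟪p - w, y - p⟫) := by
    apply saga_eps (c := c * ‖y - p‖ ^ 2)
    intro s hs hs1
    have h1 := hp (p + s • (y - p))
    have h2 := hh.2 (Set.mem_univ p) (Set.mem_univ y) (show 0 ≤ 1 - s by linarith) hs.le (by ring)
    have e1 : (1 - s) • p + s • y = p + s • (y - p) := by module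
    rw [e1] at h2
    have e2 : p + s • (y - p) - w = (p - w) + s • (y - p) := by abel
    rw [e2, norm_add_sq_real, inner_smul_right, norm_smul, mul_pow, Real.norm_eq_abs, sq_abs] at h1
    simp only [smul_eq_mul] at h2
    nlinarith
  have e3 : y - w = (p - w) + (y - p) := by abel
  rw [e3, norm_add_sq_real]
  nlinarith

lemma saga_opt {h fb : E → ℝ} (hh : ConvexOn ℝ Set.univ h) {xs g : E} {L : ℝ}
    (hf : ∀ y, fb y ≤ fb xs + ⟪g, y - xs⟫ + L / 2 * ‖y - xs‖ ^ 2)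
    (hs : ∀ y, fb xs + h xs ≤ fb y + h y) (y : E) :
    h xs ≤ h y + ⟪g, y - xs⟫ := by
  have key : h xs - h y ≤ ⟪g, y - xs⟫ := by
    apply saga_eps (c := L / 2 * ‖y - xs‖ ^ 2)
    intro s hs0 hs1
    have h1 := hs (xs + s • (y - xs))
    have h3 := hf (xs + s • (y - xs))
    have h2 := hh.2 (Set.mem_univ xs) (Set.mem_univ y) (show 0 ≤ 1 - s by linarith) hs0.le (by ring)
    have e1 : (1 - s) • xs + s • y = xs + s • (y - xs) := by module
    rw [e1] at h2
    rw [add_sub_cancel_left, inner_smul_right, norm_smul, mul_pow, Real.norm_eq_abs, sq_abs] at h3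
    simp only [smul_eq_mul] at h2
    nlinarith
  linarith

/-- Variance is at most second moment (sum form). -/
lemma saga_var {n : ℕ} (hn : 0 < n) (c : Fin n → E) :
    ∑ j, ‖c j - (1 / (n : ℝ)) • ∑ i, c i‖ ^ 2 ≤ ∑ j, ‖c j‖ ^ 2 := by
  have hn' : (0 : ℝ) < n := by exact_mod_cast hn
  set m := (1 / (n : ℝ)) • ∑ i, c i with hm
  have hs : ∑ i, c i = (n : ℝ) • m := by
    rw [hm, smul_smul]; field_simp; simp
  have : ∑ j, ‖c j - m‖ ^ 2 = ∑ j, ‖c j‖ ^ 2 - n * ‖m‖ ^ 2 := by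
    simp_rw [norm_sub_sq_real]
    rw [Finset.sum_add_distrib, Finset.sum_sub_distrib, ← Finset.mul_sum, ← sum_inner, hs,
      real_inner_smul_left, real_inner_self_eq_norm_sq]
    simp
    ring
  rw [this]
  nlinarith [sq_nonneg ‖m‖]

variable [CompleteSpace E]

lemma saga_line {f : E → ℝ} {f' : E → E} (hg : ∀ x, HasGradientAt f (f' x) x) (x v : E) (t : ℝ) :
    HasDerivAt (fun t : ℝ => f (x + t • v)) ⟪f' (x + t • v), v⟫ t := by
  have h1 := (hg (x + t • v)).hasFDerivAt
  have h2 : HasDerivAt (fun t : ℝ => x + t • v) v t := by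
    simpa using ((hasDerivAt_id t).smul_const v).const_add x
  have h3 := h1.comp_hasDerivAt t h2
  rw [InnerProductSpace.toDual_apply_apply] at h3
  exact h3

lemma saga_upper {f : E → ℝ} {f' : E → E} (hg : ∀ x, HasGradientAt f (f' x) x) {L : ℝ}
    (hs : ∀ x y, ‖f' x - f' y‖ ≤ L * ‖x - y‖) (x y : E) :
    f y ≤ f x + ⟪f' x, y - x⟫ + L / 2 * ‖y - x‖ ^ 2 := by
  set v := y - x with hv
  let φ : ℝ → ℝ := fun t => f (x + t • v) - t * ⟪f' x, v⟫ - t ^ 2 * (L / 2 * ‖v‖ ^ 2)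
  have hd : ∀ t, HasDerivAt φ (⟪f' (x + t • v), v⟫ - ⟪f' x, v⟫ - (2 * t) * (L / 2 * ‖v‖ ^ 2)) t := by
    intro t
    have a := saga_line hg x v t
    have b := (hasDerivAt_id t).mul_const ⟪f' x, v⟫
    have c := (hasDerivAt_pow 2 t).mul_const (L / 2 * ‖v‖ ^ 2)
    have e := (a.sub b).sub c
    refine HasDerivAt.congr_deriv e ?_
    simp
  have hanti : AntitoneOn φ (Set.Icc 0 1) := by
    apply antitoneOn_of_deriv_nonpos (convex_Icc 0 1)
    · exact fun t _ => (hd t).continuousAt.continuousWithinAt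
    · exact fun t _ => (hd t).differentiableAt.differentiableWithinAt
    · intro t ht
      rw [interior_Icc] at ht
      rw [(hd t).deriv, ← inner_sub_left]
      have h1 := real_inner_le_norm (f' (x + t • v) - f' x) v
      have h2 := hs (x + t • v) x
      rw [add_sub_cancel_left, norm_smul, Real.norm_eq_abs, abs_of_pos ht.1] at h2
      nlinarith [mul_le_mul_of_nonneg_right h2 (norm_nonneg v)]
  have h01 := hanti (Set.left_mem_Icc.2 zero_le_one) (Set.right_mem_Icc.2 zero_le_one) zero_le_one
  have e : x + v = y := by rw [hv]; abel
  simp [φ, e] at h01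
  linarith

lemma saga_lower {f : E → ℝ} {f' : E → E} (hg : ∀ x, HasGradientAt f (f' x) x)
    (hc : ConvexOn ℝ Set.univ f) (x y : E) :
    f x + ⟪f' x, y - x⟫ ≤ f y := by
  have hd := saga_line hg x (y - x) 0
  have hcv : ConvexOn ℝ Set.univ (fun t : ℝ => f (x + t • (y - x))) := by
    refine ⟨convex_univ, fun s _ t _ a b ha hb hab => ?_⟩
    have := hc.2 (Set.mem_univ (x + s • (y - x))) (Set.mem_univ (x + t • (y - x))) ha hb hab
    convert this using 2
    have : a = 1 - b := by linarith
    subst this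
    simp only [smul_eq_mul]
    module
  have := hcv.le_slope_of_hasDerivAt (Set.mem_univ 0) (Set.mem_univ 1) zero_lt_one hd
  simp [slope_def_field] at this
  linarith

lemma saga_coco {f : E → ℝ} {f' : E → E} (hg : ∀ x, HasGradientAt f (f' x) x)
    (hc : ConvexOn ℝ Set.univ f) {L : ℝ} (hL : 0 < L)
    (hs : ∀ x y, ‖f' x - f' y‖ ≤ L * ‖x - y‖) (x y : E) :
    f x + ⟪f' x, y - x⟫ + 1 / (2 * L) * ‖f' x - f' y‖ ^ 2 ≤ f y := by
  set r := f' x - f' y with hr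
  have h1 := saga_lower hg hc x (y + (1 / L) • r)
  have h2 := saga_upper hg hs y (y + (1 / L) • r)
  have e1 : y + (1 / L) • r - x = (y - x) + (1 / L) • r := by abel
  rw [e1, inner_add_right, inner_smul_right] at h1
  rw [add_sub_cancel_left, inner_smul_right, norm_smul, mul_pow, Real.norm_eq_abs, sq_abs] at h2
  have e2 : ⟪f' x, r⟫ = ⟪f' y, r⟫ + ‖r‖ ^ 2 := by
    rw [← real_inner_self_eq_norm_sq]
    nth_rw 3 [hr]
    rw [inner_sub_left]; ring
  rw [e2] at h1
  have e3 : L / 2 * ((1 / L) ^ 2 * ‖r‖ ^ 2) = 1 / L * ‖r‖ ^ 2 - 1 / (2 * L) * ‖r‖ ^ 2 := by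
    field_simp; ring
  nlinarith

/-- Bregman distance of `f i` to `xs`. -/
noncomputable def sagaB {n : ℕ} (f : Fin n → E → ℝ) (f' : Fin n → E → E) (xs : E)
    (i : Fin n) (x : E) : ℝ := f i x - f i xs - ⟪f' i xs, x - xs⟫

/-- Lyapunov function. -/
noncomputable def sagaPhi {n : ℕ} (L : ℝ) (f : Fin n → E → ℝ) (f' : Fin n → E → E) (xs : E)
    (x : E) (φ : Fin n → E) : ℝ :=
  15 / 2 * L * ‖x - xs‖ ^ 2 + 3 * ∑ i, sagaB f f' xs i (φ i)

/-- Objective. -/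
noncomputable def sagaF {n : ℕ} (f : Fin n → E → ℝ) (h : E → ℝ) (x : E) : ℝ :=
  (1 / (n : ℝ)) * ∑ i, f i x + h x

lemma saga_young {a b : E} {c : ℝ} (hc : 0 < c) : -⟪a, b⟫ ≤ 1 / (4 * c) * ‖a‖ ^ 2 + c * ‖b‖ ^ 2 := by
  have h1 := neg_le_of_abs_le (abs_real_inner_le_norm a b)
  have : 1 / (4 * c) * ‖a‖ ^ 2 + c * ‖b‖ ^ 2 - ‖a‖ * ‖b‖ = c * (‖a‖ / (2 * c) - ‖b‖) ^ 2 := by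
    field_simp; ring
  nlinarith [mul_nonneg hc.le (sq_nonneg (‖a‖ / (2 * c) - ‖b‖))]

lemma saga_step {n : ℕ} (hn : 0 < n) {L : ℝ} (hL : 0 < L)
    {f : Fin n → E → ℝ} {f' : Fin n → E → E}
    (hgrad : ∀ i x, HasGradientAt (f i) (f' i x) x)
    (hconv : ∀ i, ConvexOn ℝ Set.univ (f i))
    (hsmooth : ∀ i x y, ‖f' i x - f' i y‖ ≤ L * ‖x - y‖)
    {h : E → ℝ} (hh : ConvexOn ℝ Set.univ h) {xs : E}
    (hstar : ∀ y, sagaF f h xs ≤ sagaF f h y)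
    (x : E) (φ p : Fin n → E)
    (hp : ∀ j y, h (p j) + 3 * L / 2 *
        ‖p j - (x - (1 / (3 * L)) • (f' j x - f' j (φ j) + (1 / (n : ℝ)) • ∑ i, f' i (φ i)))‖ ^ 2
      ≤ h y + 3 * L / 2 *
        ‖y - (x - (1 / (3 * L)) • (f' j x - f' j (φ j) + (1 / (n : ℝ)) • ∑ i, f' i (φ i)))‖ ^ 2) :
    ∑ j, (sagaF f h (p j) - sagaF f h xs + sagaPhi L f f' xs (p j) (Function.update φ j x))
      ≤ n * sagaPhi L f f' xs x φ := by
  have hn' : (0 : ℝ) < n := by exact_mod_cast hn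
  set G : E → E := fun y => (1 / (n : ℝ)) • ∑ i, f' i y with hG
  set fb : E → ℝ := fun y => (1 / (n : ℝ)) * ∑ i, f i y with hfb
  set a : Fin n → E := fun j => f' j x - f' j xs with ha
  set c : Fin n → E := fun j => f' j (φ j) - f' j xs with hcd
  set v : Fin n → E := fun j => f' j x - f' j (φ j) + (1 / (n : ℝ)) • ∑ i, f' i (φ i) with hv
  -- average bounds
  have avgU : ∀ y z, fb z ≤ fb y + ⟪G y, z - y⟫ + L / 2 * ‖z - y‖ ^ 2 := by
    intro y z
    have h1 : ∑ i, f i z ≤ ∑ i, (f i y + ⟪f' i y, z - y⟫ + L / 2 * ‖z - y‖ ^ 2) :=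
      Finset.sum_le_sum fun i _ => saga_upper (hgrad i) (hsmooth i) y z
    rw [Finset.sum_add_distrib, Finset.sum_add_distrib, ← sum_inner, Finset.sum_const,
      Finset.card_univ, Fintype.card_fin, nsmul_eq_mul] at h1
    have h2 := mul_le_mul_of_nonneg_left h1 (show 0 ≤ 1 / (n : ℝ) by positivity)
    simp only [hfb, hG, real_inner_smul_left]
    refine h2.trans (le_of_eq ?_)
    field_simp
  have avgL : ∀ y z, fb y + ⟪G y, z - y⟫ ≤ fb z := by
    intro y z
    have h1 : ∑ i, (f i y + ⟪f' i y, z - y⟫) ≤ ∑ i, f i z :=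
      Finset.sum_le_sum fun i _ => saga_lower (hgrad i) (hconv i) y z
    rw [Finset.sum_add_distrib, ← sum_inner] at h1
    have h2 := mul_le_mul_of_nonneg_left h1 (show 0 ≤ 1 / (n : ℝ) by positivity)
    simp only [hfb, hG, real_inner_smul_left]
    refine le_trans (le_of_eq ?_) h2
    ring
  have hopt : ∀ y, h xs ≤ h y + ⟪G xs, y - xs⟫ := saga_opt hh (avgU xs) hstar
  -- three point inequality
  have three : ∀ j, h (p j) - h xs ≤ 3 * L / 2 * (‖x - xs‖ ^ 2 - ‖p j - xs‖ ^ 2 - ‖p j - x‖ ^ 2)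
      - ⟪v j, p j - xs⟫ := by
    intro j
    have h1 := saga_prox_three hh (hp j) xs
    change h (p j) + 3 * L / 2 * ‖p j - (x - (1 / (3 * L)) • v j)‖ ^ 2 + 3 * L / 2 * ‖xs - p j‖ ^ 2
      ≤ h xs + 3 * L / 2 * ‖xs - (x - (1 / (3 * L)) • v j)‖ ^ 2 at h1
    have e1 : p j - (x - (1 / (3 * L)) • v j) = (p j - x) + (1 / (3 * L)) • v j := by abel
    have e2 : xs - (x - (1 / (3 * L)) • v j) = -(x - xs) + (1 / (3 * L)) • v j := by abel
    have e3 : ⟪v j, p j - xs⟫ = ⟪v j, p j - x⟫ + ⟪v j, x - xs⟫ := by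
      rw [← inner_add_right]; congr 1; abel
    rw [e1, e2, norm_add_sq_real, norm_add_sq_real, inner_neg_left, norm_neg, inner_smul_right,
      inner_smul_right, real_inner_comm, real_inner_comm (v j) (x - xs), norm_sub_rev xs] at h1
    rw [e3]
    have e4 : ∀ q : ℝ, 3 * L / 2 * (2 * (1 / (3 * L) * q)) = q := by intro q; field_simp
    have e5 := e4 ⟪v j, p j - x⟫
    have e6 := e4 ⟪v j, x - xs⟫
    linarith
  -- second bound
  have II : ∀ j, 3 * L / 2 * ‖p j - xs‖ ^ 2 ≤ 3 * L / 2 * ‖x - xs‖ ^ 2 - ⟪v j - G xs, x - xs⟫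
      + 1 / (6 * L) * ‖v j - G xs‖ ^ 2 := by
    intro j
    have h1 := three j
    have h2 := hopt (p j)
    have h3 := saga_young (a := v j - G xs) (b := p j - x) (c := 3 * L / 2) (by positivity)
    have e3 : ∀ q : E, ⟪q, p j - xs⟫ = ⟪q, p j - x⟫ + ⟪q, x - xs⟫ := by
      intro q; rw [← inner_add_right]; congr 1; abel
    have e4 : 4 * (3 * L / 2) = 6 * L := by ring
    rw [e4] at h3
    rw [e3] at h1 h2
    simp only [inner_sub_left] at h3 ⊢
    linarith
  have I : ∀ j, sagaF f h (p j) - sagaF f h xs ≤ 3 * L / 2 * (‖x - xs‖ ^ 2 - ‖p j - xs‖ ^ 2)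
      - ⟪v j - G x, x - xs⟫ + 1 / (4 * L) * ‖v j - G x‖ ^ 2 := by
    intro j
    have h1 := three j
    have h2 := avgU x (p j)
    have h4 := avgL x xs
    have h3 := saga_young (a := v j - G x) (b := p j - x) (c := L) hL
    have e3 : ∀ q : E, ⟪q, p j - xs⟫ = ⟪q, p j - x⟫ + ⟪q, x - xs⟫ := by
      intro q; rw [← inner_add_right]; congr 1; abel
    have e5 : ⟪G x, xs - x⟫ = - ⟪G x, x - xs⟫ := by rw [← inner_neg_right, neg_sub]
    rw [e3] at h1
    rw [e5] at h4
    change fb (p j) + h (p j) - (fb xs + h xs) ≤ _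
    simp only [inner_sub_left] at h3 ⊢
    linarith
  -- decompositions
  have hbar : (1 / (n : ℝ)) • ∑ i, f' i (φ i) = (1 / (n : ℝ)) • ∑ i, c i + G xs := by
    simp only [hG, hcd, Finset.sum_sub_distrib, smul_sub]; abel
  have dII : ∀ j, v j - G xs = a j - (c j - (1 / (n : ℝ)) • ∑ i, c i) := by
    intro j; simp only [hv, hbar, ha, hcd]; abel
  have dI : ∀ j, v j - G x = (a j - c j) - (1 / (n : ℝ)) • ∑ i, (a i - c i) := by
    intro j
    have : ∀ i, a i - c i = f' i x - f' i (φ i) := by intro i; simp only [ha, hcd]; abel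
    simp only [this, Finset.sum_sub_distrib, smul_sub, hv, hG]; abel
  have smean : ∀ q : Fin n → E, ∑ j, (q j - (1 / (n : ℝ)) • ∑ i, q i) = 0 := by
    intro q
    rw [Finset.sum_sub_distrib, Finset.sum_const, Finset.card_univ, Fintype.card_fin,
      ← Nat.cast_smul_eq_nsmul ℝ, smul_smul, mul_one_div_cancel hn'.ne', one_smul, sub_self]
  have sI : ∑ j, ⟪v j - G x, x - xs⟫ = 0 := by
    rw [← sum_inner, Finset.sum_congr rfl (fun j _ => dI j), smean (fun i => a i - c i),
      inner_zero_left]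
  have sII : ∑ j, ⟪v j - G xs, x - xs⟫ = ∑ j, ⟪a j, x - xs⟫ := by
    rw [← sum_inner, ← sum_inner, Finset.sum_congr rfl (fun j _ => dII j), Finset.sum_sub_distrib,
      smean c, sub_zero]
  have nI : ∑ j, ‖v j - G x‖ ^ 2 ≤ 2 * ∑ j, ‖a j‖ ^ 2 + 2 * ∑ j, ‖c j‖ ^ 2 := by
    rw [Finset.sum_congr rfl (fun j _ => by rw [dI j])]
    refine (saga_var hn (fun j => a j - c j)).trans ?_
    rw [Finset.mul_sum, Finset.mul_sum, ← Finset.sum_add_distrib]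
    refine Finset.sum_le_sum fun j _ => ?_
    have := parallelogram_law_with_norm ℝ (a j) (c j)
    nlinarith [sq_nonneg ‖a j + c j‖]
  have nII : ∑ j, ‖v j - G xs‖ ^ 2 ≤ 3 * ∑ j, ‖a j‖ ^ 2 + 3 / 2 * ∑ j, ‖c j‖ ^ 2 := by
    have h1 := saga_var hn c
    have h2 : ∑ j, ‖v j - G xs‖ ^ 2 ≤ ∑ j, (3 * ‖a j‖ ^ 2
        + 3 / 2 * ‖c j - (1 / (n : ℝ)) • ∑ i, c i‖ ^ 2) := by
      refine Finset.sum_le_sum fun j _ => ?_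
      rw [dII j, norm_sub_sq_real]
      have := saga_young (a := a j) (b := c j - (1 / (n : ℝ)) • ∑ i, c i) (c := 1 / 4) (by norm_num)
      norm_num at this ⊢
      linarith
    rw [Finset.sum_add_distrib, ← Finset.mul_sum, ← Finset.mul_sum] at h2
    linarith
  -- Bregman
  have bA : ∀ j, 1 / (2 * L) * ‖a j‖ ^ 2 ≤ sagaB f f' xs j x := by
    intro j
    have := saga_coco (hgrad j) (hconv j) hL (hsmooth j) xs x
    rw [norm_sub_rev] at this
    simp only [ha, sagaB]; linarith
  have bC : ∀ j, 1 / (2 * L) * ‖c j‖ ^ 2 ≤ sagaB f f' xs j (φ j) := by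
    intro j
    have := saga_coco (hgrad j) (hconv j) hL (hsmooth j) xs (φ j)
    rw [norm_sub_rev] at this
    simp only [hcd, sagaB]; linarith
  have bI : ∀ j, sagaB f f' xs j x + 1 / (2 * L) * ‖a j‖ ^ 2 ≤ ⟪a j, x - xs⟫ := by
    intro j
    have := saga_coco (hgrad j) (hconv j) hL (hsmooth j) x xs
    have e5 : ⟪f' j x, xs - x⟫ = - ⟪f' j x, x - xs⟫ := by rw [← inner_neg_right, neg_sub]
    rw [e5] at this
    simp only [ha, sagaB, inner_sub_left]; linarith
  have sbA := Finset.sum_le_sum fun j (_ : j ∈ Finset.univ) => bA j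
  have sbC := Finset.sum_le_sum fun j (_ : j ∈ Finset.univ) => bC j
  have sbI := Finset.sum_le_sum fun j (_ : j ∈ Finset.univ) => bI j
  have SI := Finset.sum_le_sum fun j (_ : j ∈ Finset.univ) => I j
  have SII := Finset.sum_le_sum fun j (_ : j ∈ Finset.univ) => II j
  have upd : ∀ j, ∑ i, sagaB f f' xs i (Function.update φ j x i)
      = ∑ i, sagaB f f' xs i (φ i) - sagaB f f' xs j (φ j) + sagaB f f' xs j x := by
    intro j
    rw [← Finset.add_sum_erase _ _ (Finset.mem_univ j),
      ← Finset.add_sum_erase _ (fun i => sagaB f f' xs i (φ i)) (Finset.mem_univ j)]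
    have : ∑ i ∈ Finset.univ.erase j, sagaB f f' xs i (Function.update φ j x i)
        = ∑ i ∈ Finset.univ.erase j, sagaB f f' xs i (φ i) :=
      Finset.sum_congr rfl fun i hi => by rw [Function.update_of_ne (Finset.ne_of_mem_erase hi)]
    rw [this, Function.update_self]; ring
  simp only [sagaPhi, upd]
  simp only [Finset.sum_add_distrib, Finset.sum_sub_distrib, ← Finset.mul_sum, Finset.sum_const,
    Finset.card_univ, Fintype.card_fin, nsmul_eq_mul, sI, sII] at SI SII sbA sbC sbI ⊢
  have i4 : 1 / (4 * L) = 1 / (2 * L) / 2 := by field_simp; norm_num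
  have i6 : 1 / (6 * L) = 1 / (2 * L) / 3 := by field_simp; norm_num
  rw [i4] at SI
  rw [i6] at SII
  have hK : 0 < 1 / (2 * L) := by positivity
  generalize 1 / (2 * L) = K at *
  have nI' := mul_le_mul_of_nonneg_left nI hK.le
  have nII' := mul_le_mul_of_nonneg_left nII hK.le
  linarith

end SagaAux

lemma sagaIter_congr {d n : ℕ} {γ : ℝ}
    {f' : Fin n → EuclideanSpace ℝ (Fin d) → EuclideanSpace ℝ (Fin d)}
    {prox : EuclideanSpace ℝ (Fin d) → EuclideanSpace ℝ (Fin d)}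
    {x0 : EuclideanSpace ℝ (Fin d)} (js js' : ℕ → Fin n) (t : ℕ) (hjs : ∀ s < t, js s = js' s) :
    sagaIter d n γ f' prox x0 js t = sagaIter d n γ f' prox x0 js' t := by
  induction t with
  | zero => rfl
  | succ t ih =>
    simp only [sagaIter, ih (fun s hs => hjs s (by omega)), hjs t (by omega)]

lemma extSeq_snoc_lt {n : ℕ} (hn : 0 < n) {k : ℕ} (js : Fin k → Fin n) (j : Fin n) (s : ℕ)
    (hs : s < k) : extSeq hn (Fin.snoc js j : Fin (k + 1) → Fin n) s = extSeq hn js s := by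
  have : s < k + 1 := by omega
  simp [extSeq, hs, this, Fin.snoc]

lemma extSeq_snoc_last {n : ℕ} (hn : 0 < n) {k : ℕ} (js : Fin k → Fin n) (j : Fin n) :
    extSeq hn (Fin.snoc js j : Fin (k + 1) → Fin n) k = j := by
  simp [extSeq, Fin.snoc]

lemma saga_sum_snoc {n k : ℕ} (T : (Fin (k + 1) → Fin n) → ℝ) :
    ∑ js, T js = ∑ js : Fin k → Fin n, ∑ j, T (Fin.snoc js j) := by
  rw [← (Fin.snocEquiv (fun _ : Fin (k + 1) => Fin n)).sum_comp, Fintype.sum_prod_type,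
    Finset.sum_comm]
  rfl

theorem saga_convergence_non_strongly_convex (d n k : ℕ) (hn : 0 < n) (hk : 1 ≤ k)
    (L γ : ℝ) (hL : 0 < L) (hγ : γ = 1 / (3 * L))
    (f : Fin n → EuclideanSpace ℝ (Fin d) → ℝ)
    (f' : Fin n → EuclideanSpace ℝ (Fin d) → EuclideanSpace ℝ (Fin d))
    (hgrad : ∀ i x, HasGradientAt (f i) (f' i x) x)
    (hconv : ∀ i, ConvexOn ℝ Set.univ (f i))
    (hsmooth : ∀ i x y, ‖f' i x - f' i y‖ ≤ L * ‖x - y‖)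
    (h : EuclideanSpace ℝ (Fin d) → ℝ) (hh : ConvexOn ℝ Set.univ h)
    (xstar : EuclideanSpace ℝ (Fin d))
    (hstar : ∀ y, (1 / (n : ℝ)) * ∑ i, f i xstar + h xstar
        ≤ (1 / (n : ℝ)) * ∑ i, f i y + h y)
    (prox : EuclideanSpace ℝ (Fin d) → EuclideanSpace ℝ (Fin d))
    (hprox : ∀ w y, h (prox w) + 1 / (2 * γ) * ‖prox w - w‖ ^ 2
        ≤ h y + 1 / (2 * γ) * ‖y - w‖ ^ 2)
    (x0 : EuclideanSpace ℝ (Fin d)) :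
    (1 / (n : ℝ) ^ k) * ∑ js : Fin k → Fin n,
        (((1 / (n : ℝ)) * ∑ i, f i ((1 / (k : ℝ)) •
              ∑ t ∈ Finset.range k, (sagaIter d n γ f' prox x0 (extSeq hn js) (t + 1)).1)
            + h ((1 / (k : ℝ)) •
              ∑ t ∈ Finset.range k, (sagaIter d n γ f' prox x0 (extSeq hn js) (t + 1)).1))
          - ((1 / (n : ℝ)) * ∑ i, f i xstar + h xstar))
      ≤ (10 * (n : ℝ) / k) *
          ((2 * L / n) * ‖x0 - xstar‖ ^ 2
            + (1 / (n : ℝ)) * ∑ i, f i x0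
            - ⟪(1 / (n : ℝ)) • ∑ i, f' i xstar, x0 - xstar⟫
            - (1 / (n : ℝ)) * ∑ i, f i xstar) := by
  subst hγ
  have hn' : (0 : ℝ) < n := by exact_mod_cast hn
  have hk' : (0 : ℝ) < k := by exact_mod_cast hk
  have hw : 1 / (2 * (1 / (3 * L))) = 3 * L / 2 := by field_simp
  rw [hw] at hprox
  set X : (ℕ → Fin n) → ℕ → _ := fun js t => sagaIter d n (1 / (3 * L)) f' prox x0 js t with hX
  have main : ∀ m : ℕ, ∑ js : Fin m → Fin n,
      (∑ t ∈ Finset.range m, (sagaF f h (X (extSeq hn js) (t + 1)).1 - sagaF f h xstar)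
        + sagaPhi L f f' xstar (X (extSeq hn js) m).1 (X (extSeq hn js) m).2)
      ≤ (n : ℝ) ^ m * sagaPhi L f f' xstar x0 (fun _ => x0) := by
    intro m
    induction m with
    | zero => simp [hX, sagaIter]
    | succ m ih =>
      rw [saga_sum_snoc]
      have := mul_le_mul_of_nonneg_left ih hn'.le
      rw [pow_succ']
      rw [mul_assoc]
      refine le_trans ?_ this
      rw [Finset.mul_sum]
      refine Finset.sum_le_sum fun js _ => ?_
      have hcong : ∀ j, ∀ t ≤ m, X (extSeq hn (Fin.snoc js j : Fin (m + 1) → Fin n)) t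
          = X (extSeq hn js) t := fun j t ht =>
        sagaIter_congr _ _ _ fun s hs => extSeq_snoc_lt hn js j s (by omega)
      set st := X (extSeq hn js) m with hst
      have hlast : ∀ j, X (extSeq hn (Fin.snoc js j : Fin (m + 1) → Fin n)) (m + 1)
          = (prox (sagaW d n (1 / (3 * L)) f' st.1 st.2 j), Function.update st.2 j st.1) := by
        intro j
        have := hcong j m le_rfl
        simp only [hX] at this ⊢
        rw [sagaIter, this, extSeq_snoc_last]
      have hstep := saga_step hn hL hgrad hconv hsmooth hh (xs := xstar) hstar st.1 st.2
        (fun j => prox (sagaW d n (1 / (3 * L)) f' st.1 st.2 j)) (fun j y => hprox _ y)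
      have hsum : ∀ j, ∑ t ∈ Finset.range m,
          (sagaF f h (X (extSeq hn (Fin.snoc js j : Fin (m + 1) → Fin n)) (t + 1)).1
            - sagaF f h xstar)
          = ∑ t ∈ Finset.range m, (sagaF f h (X (extSeq hn js) (t + 1)).1 - sagaF f h xstar) :=
        fun j => Finset.sum_congr rfl fun t ht => by
          rw [hcong j (t + 1) (by have := Finset.mem_range.1 ht; omega)]
      simp only [Finset.sum_range_succ, hsum, hlast]
      simp only [add_assoc] at hstep ⊢
      rw [Finset.sum_add_distrib, Finset.sum_const, Finset.card_univ, Fintype.card_fin,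
        nsmul_eq_mul]
      linarith
  have hB : ∀ i x, 0 ≤ sagaB f f' xstar i x := fun i x => by
    have := saga_lower (hgrad i) (hconv i) xstar x
    simp only [sagaB]; linarith
  have hPhi : ∀ x φ, 0 ≤ sagaPhi L f f' xstar x φ := fun x φ => by
    have := Finset.sum_nonneg fun i (_ : i ∈ Finset.univ) => hB i (φ i)
    simp only [sagaPhi]; positivity
  have hFc : ConvexOn ℝ Set.univ (sagaF f h) := by
    have h1 : ConvexOn ℝ Set.univ (fun x => ∑ i, f i x) := by
      refine ⟨convex_univ, fun s _ t _ a b ha hb hab => ?_⟩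
      simp only [Finset.smul_sum, ← Finset.sum_add_distrib]
      exact Finset.sum_le_sum fun i _ => (hconv i).2 (Set.mem_univ _) (Set.mem_univ _) ha hb hab
    exact (h1.smul (show 0 ≤ 1 / (n : ℝ) by positivity)).add hh
  have jensen : ∀ js : Fin k → Fin n,
      sagaF f h ((1 / (k : ℝ)) • ∑ t ∈ Finset.range k, (X (extSeq hn js) (t + 1)).1)
        - sagaF f h xstar
      ≤ 1 / k * (∑ t ∈ Finset.range k, (sagaF f h (X (extSeq hn js) (t + 1)).1 - sagaF f h xstar)
        + sagaPhi L f f' xstar (X (extSeq hn js) k).1 (X (extSeq hn js) k).2) := by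
    intro js
    have h1 := hFc.map_sum_le (t := Finset.range k) (w := fun _ => 1 / (k : ℝ))
      (p := fun t => (X (extSeq hn js) (t + 1)).1) (fun _ _ => by positivity)
      (by simp [hk'.ne']) (fun _ _ => Set.mem_univ _)
    rw [← Finset.smul_sum, ← Finset.smul_sum, smul_eq_mul] at h1
    have h2 := mul_nonneg (show 0 ≤ 1 / (k : ℝ) by positivity)
      (hPhi (X (extSeq hn js) k).1 (X (extSeq hn js) k).2)
    rw [Finset.sum_sub_distrib, Finset.sum_const, Finset.card_range, nsmul_eq_mul, mul_add, mul_sub,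
      ← mul_assoc, one_div_mul_cancel hk'.ne', one_mul]
    linarith
  have tot := Finset.sum_le_sum fun js (_ : js ∈ Finset.univ) => jensen js
  rw [← Finset.mul_sum] at tot
  have tot2 := tot.trans (mul_le_mul_of_nonneg_left (main k) (show 0 ≤ 1 / (k : ℝ) by positivity))
  have tot3 := mul_le_mul_of_nonneg_left tot2 (show 0 ≤ 1 / (n : ℝ) ^ k by positivity)
  refine tot3.trans ?_
  have e1 : 1 / (n : ℝ) ^ k * (1 / k * (n ^ k * sagaPhi L f f' xstar x0 fun _ => x0))
      = 1 / k * sagaPhi L f f' xstar x0 fun _ => x0 := by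
    field_simp
  rw [e1]
  have hS := Finset.sum_nonneg fun i (_ : i ∈ Finset.univ) => hB i x0
  have e2 : (10 * (n : ℝ) / k) *
          ((2 * L / n) * ‖x0 - xstar‖ ^ 2
            + (1 / (n : ℝ)) * ∑ i, f i x0
            - ⟪(1 / (n : ℝ)) • ∑ i, f' i xstar, x0 - xstar⟫
            - (1 / (n : ℝ)) * ∑ i, f i xstar)
      = 1 / k * (20 * L * ‖x0 - xstar‖ ^ 2 + 10 * ∑ i, sagaB f f' xstar i x0) := by
    simp only [sagaB, Finset.sum_sub_distrib, real_inner_smul_left, sum_inner]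
    field_simp
    ring
  rw [e2]
  refine mul_le_mul_of_nonneg_left ?_ (by positivity)
  simp only [sagaPhi]
  nlinarith [mul_nonneg hL.le (sq_nonneg ‖x0 - xstar‖)]
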